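/- There exists a universal constant C > 0 such that for all k₁, k₂ ∈ ℤ³ with k₁₂ := k₁ + k₂ ≠ 0 and all real numbers t ≥ 0, 0 ≤ s ≤ t, 0 ≤ s̄ ≤ t: ∫_0^s ∫_0^{s̄} e^{−(‖k₁‖²+‖k₂‖²)|σ−σ̄|} ( e^{−‖k₁₂‖²(s−σ)} − e^{−‖k₁₂‖²(t−σ)} ) ( e^{−‖k₁₂‖²(s̄−σ̄)} − e^{−‖k₁₂‖²(t−σ̄)} ) dσ̄ dσ + ∫_s^t ∫_{s̄}^t e^{−(‖k₁‖²+‖k₂‖²)|σ−σ̄|} e^{−‖k₁₂‖²((t−σ)+(t−σ̄))} dσ̄ dσ ≤ C ‖k₁₂‖^{−3} (t−s)^{1/4} (t−s̄)^{1/4}. -/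

import Mathlib

/-- The Euclidean norm of a lattice point `k ∈ ℤ³`, regarded as a vector in `ℝ³`. -/
noncomputable def zNorm (k : Fin 3 → ℤ) : ℝ :=
  Real.sqrt (∑ i, ((k i : ℝ)) ^ 2)

open MeasureTheory

theorem zNorm_pos {k : Fin 3 → ℤ} (hk : k ≠ 0) : 0 < zNorm k := by
  obtain ⟨i, hi⟩ := Function.ne_iff.mp hk
  have hi' : (k i : ℝ) ≠ 0 := by exact_mod_cast hi
  exact Real.sqrt_pos.mpr
    (Finset.sum_pos' (fun j _ => sq_nonneg _) ⟨i, Finset.mem_univ i, by positivity⟩)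

theorem intervalIntegral_mul_mul_le_of_le_one {K : ℝ → ℝ → ℝ} {f g : ℝ → ℝ}
    (hK : Continuous (Function.uncurry K)) (hK_le : ∀ x y, K x y ≤ 1)
    (hf : Continuous f) (hg : Continuous g) (hf_nonneg : ∀ x, 0 ≤ f x) (hg_nonneg : ∀ y, 0 ≤ g y)
    {a b c d : ℝ} (hab : a ≤ b) (hcd : c ≤ d) :
    (∫ x in a..b, ∫ y in c..d, K x y * f x * g y) ≤ (∫ x in a..b, f x) * ∫ y in c..d, g y := by
  have hcont : Continuous (Function.uncurry fun x y => K x y * f x * g y) := by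
    change Continuous fun p : ℝ × ℝ => Function.uncurry K p * f p.1 * g p.2
    fun_prop
  rw [← intervalIntegral.integral_mul_const]
  refine intervalIntegral.integral_mono_on hab ?_ ?_ fun x _ => ?_
  · exact (intervalIntegral.continuous_parametric_intervalIntegral_of_continuous' hcont c d
      ).intervalIntegrable _ _
  · exact (hf.mul continuous_const).intervalIntegrable _ _
  · rw [← intervalIntegral.integral_const_mul]
    refine intervalIntegral.integral_mono_on hcd ?_ ?_ fun y _ => ?_
    · exact (hcont.comp (Continuous.prodMk_right x)).intervalIntegrable _ _
    · exact (continuous_const.mul hg).intervalIntegrable _ _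
    · exact mul_le_mul_of_nonneg_right (mul_le_of_le_one_left (hf_nonneg x) (hK_le x y))
        (hg_nonneg y)

theorem one_sub_exp_neg_le_rpow {x r : ℝ} (hx : 0 ≤ x) (hr : 0 ≤ r) (hr_le : r ≤ 1) :
    1 - Real.exp (-x) ≤ x ^ r := by
  rcases le_total x 1 with h | h
  · have := Real.add_one_le_exp (-x)
    have := Real.rpow_le_rpow_of_exponent_ge_of_imp hx h hr_le (by intro _ h0; linarith)
    rw [Real.rpow_one] at this
    linarith
  · have := Real.exp_pos (-x)
    have := Real.one_le_rpow h hr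
    linarith

theorem integral_exp_neg_mul_sub {a : ℝ} (ha : a ≠ 0) (p q T : ℝ) :
    (∫ x in p..q, Real.exp (-a * (T - x)))
      = (Real.exp (-a * (T - q)) - Real.exp (-a * (T - p))) / a := by
  rw [sub_div]
  refine intervalIntegral.integral_eq_sub_of_hasDerivAt
    (f := fun x => Real.exp (-a * (T - x)) / a) (fun x _ => ?_)
    ((by fun_prop : Continuous fun x => Real.exp (-a * (T - x))).intervalIntegrable _ _)
  have h := ((((hasDerivAt_id x).const_sub T).const_mul (-a)).exp).div_const a
  rwa [neg_mul_neg, mul_one, mul_div_cancel_right₀ _ ha] at h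

theorem one_sub_exp_neg_sq_mul_div_le {n u : ℝ} (hn : 0 < n) (hu : 0 ≤ u) :
    (1 - Real.exp (-n ^ 2 * u)) / n ^ 2 ≤ n ^ (-(3 : ℝ) / 2) * u ^ ((1 : ℝ) / 4) := by
  have h := one_sub_exp_neg_le_rpow (x := n ^ 2 * u) (r := 1 / 4) (by positivity)
    (by norm_num) (by norm_num)
  have hpow : n ^ (-(3 : ℝ) / 2) * n ^ 2 = (n ^ 2) ^ ((1 : ℝ) / 4) := by
    rw [← Real.rpow_natCast, ← Real.rpow_add hn, ← Real.rpow_mul hn.le]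
    norm_num
  rw [div_le_iff₀ (by positivity), mul_right_comm, hpow, ← Real.mul_rpow (by positivity) hu,
    neg_mul]
  exact h

theorem integral_exp_sub_exp_le {n s t : ℝ} (hn : 0 < n) (hst : s ≤ t) :
    (∫ x in (0 : ℝ)..s, (Real.exp (-n ^ 2 * (s - x)) - Real.exp (-n ^ 2 * (t - x))))
      ≤ n ^ (-(3 : ℝ) / 2) * (t - s) ^ ((1 : ℝ) / 4) := by
  have hint (T : ℝ) : IntervalIntegrable (fun x => Real.exp (-n ^ 2 * (T - x))) volume 0 s :=
    (by fun_prop : Continuous fun x => Real.exp (-n ^ 2 * (T - x))).intervalIntegrable _ _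
  rw [intervalIntegral.integral_sub (hint s) (hint t),
    integral_exp_neg_mul_sub (by positivity), integral_exp_neg_mul_sub (by positivity), ← sub_div]
  refine le_trans ?_ (one_sub_exp_neg_sq_mul_div_le hn (sub_nonneg.mpr hst))
  have h : Real.exp (-n ^ 2 * (t - 0)) ≤ Real.exp (-n ^ 2 * (s - 0)) :=
    Real.exp_le_exp.mpr (by nlinarith [sq_nonneg n])
  rw [sub_self, mul_zero, Real.exp_zero]
  exact div_le_div_of_nonneg_right (by linarith) (sq_nonneg n)

theorem integral_exp_le {n s t : ℝ} (hn : 0 < n) (hst : s ≤ t) :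
    (∫ x in s..t, Real.exp (-n ^ 2 * (t - x)))
      ≤ n ^ (-(3 : ℝ) / 2) * (t - s) ^ ((1 : ℝ) / 4) := by
  rw [integral_exp_neg_mul_sub (by positivity), sub_self, mul_zero, Real.exp_zero]
  exact one_sub_exp_neg_sq_mul_div_le hn (sub_nonneg.mpr hst)

/-- The two-variable time-integral kernel estimate (216): there is a universal `C > 0`
such that for all `k₁, k₂ ∈ ℤ³` with `k₁ + k₂ ≠ 0` and all `0 ≤ s ≤ t`, `0 ≤ s' ≤ t`,
the sum of the two double time integrals is at most
`C ‖k₁+k₂‖^{-3} (t-s)^{1/4} (t-s')^{1/4}`. -/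
theorem double_time_integral_kernel_bound :
    ∃ C : ℝ, 0 < C ∧ ∀ k₁ k₂ : Fin 3 → ℤ, k₁ + k₂ ≠ 0 →
      ∀ t s s' : ℝ, 0 ≤ t → 0 ≤ s → s ≤ t → 0 ≤ s' → s' ≤ t →
      (∫ σ in (0 : ℝ)..s, ∫ σ' in (0 : ℝ)..s',
          Real.exp (-(zNorm k₁ ^ 2 + zNorm k₂ ^ 2) * |σ - σ'|)
            * (Real.exp (-zNorm (k₁ + k₂) ^ 2 * (s - σ))
                - Real.exp (-zNorm (k₁ + k₂) ^ 2 * (t - σ)))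
            * (Real.exp (-zNorm (k₁ + k₂) ^ 2 * (s' - σ'))
                - Real.exp (-zNorm (k₁ + k₂) ^ 2 * (t - σ'))))
        + (∫ σ in s..t, ∫ σ' in s'..t,
            Real.exp (-(zNorm k₁ ^ 2 + zNorm k₂ ^ 2) * |σ - σ'|)
              * Real.exp (-zNorm (k₁ + k₂) ^ 2 * ((t - σ) + (t - σ'))))
        ≤ C * zNorm (k₁ + k₂) ^ (-(3 : ℝ)) * (t - s) ^ ((1 : ℝ) / 4)
            * (t - s') ^ ((1 : ℝ) / 4) := by
  refine ⟨2, two_pos, fun k₁ k₂ hk t s s' _ hs hst hs' hst' => ?_⟩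
  have hn := zNorm_pos hk
  set n := zNorm (k₁ + k₂)
  set A := zNorm k₁ ^ 2 + zNorm k₂ ^ 2
  have hK : Continuous (Function.uncurry fun σ σ' : ℝ => Real.exp (-A * |σ - σ'|)) := by
    change Continuous fun p : ℝ × ℝ => Real.exp (-A * |p.1 - p.2|)
    fun_prop
  have hK_le (σ σ' : ℝ) : Real.exp (-A * |σ - σ'|) ≤ 1 := by
    rw [Real.exp_le_one_iff, neg_mul, neg_nonpos]
    positivity
  have hdiff {r : ℝ} (hr : r ≤ t) (σ : ℝ) :
      0 ≤ Real.exp (-n ^ 2 * (r - σ)) - Real.exp (-n ^ 2 * (t - σ)) :=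
    sub_nonneg.mpr (Real.exp_le_exp.mpr (by nlinarith [sq_nonneg n]))
  have hnn : n ^ (-(3 : ℝ) / 2) * n ^ (-(3 : ℝ) / 2) = n ^ (-(3 : ℝ)) := by
    rw [← Real.rpow_add hn]
    norm_num
  have hu : 0 ≤ t - s := sub_nonneg.mpr hst
  have hv : 0 ≤ t - s' := sub_nonneg.mpr hst'
  have h₁ := (intervalIntegral_mul_mul_le_of_le_one hK hK_le (by fun_prop) (by fun_prop)
    (hdiff hst) (hdiff hst') hs hs').trans
    (mul_le_mul (integral_exp_sub_exp_le hn hst) (integral_exp_sub_exp_le hn hst')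
      (intervalIntegral.integral_nonneg hs' fun x _ => hdiff hst' x) (by positivity))
  have h₂ := (intervalIntegral_mul_mul_le_of_le_one hK hK_le
    (f := fun σ => Real.exp (-n ^ 2 * (t - σ))) (g := fun σ => Real.exp (-n ^ 2 * (t - σ)))
    (by fun_prop) (by fun_prop) (fun _ => (Real.exp_pos _).le) (fun _ => (Real.exp_pos _).le)
    hst hst').trans
    (mul_le_mul (integral_exp_le hn hst) (integral_exp_le hn hst')
      (intervalIntegral.integral_nonneg hst' fun x _ => (Real.exp_pos _).le) (by positivity))
  rw [mul_mul_mul_comm, hnn] at h₁ h₂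
  simp only [mul_add, Real.exp_add, ← mul_assoc] at h₁ h₂ ⊢
  linarith
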